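/- Let a < 0 < b and m ∈ (0,1] with s := (1−m)·a + m·b > 0, θ₂ := −s, c₁ := a·b/s, c₂ := m·a + (1−m)·b − a·b/s, and G_r(x) := c₁ + c₂·e^{θ₂·x} for x ≥ 0. Let t₀ ∈ ℝ, C > 0, and let W : (−∞,t₀] → ℝ be continuous with |W(t)| ≤ C·e^{−2a·t} for all t ≤ t₀. Define φ(t) := W(t) + ∫_{−∞}^t G_r(t−η)·W(η) dη for t ≤ t₀ (all integrals converging absolutely). Then φ is continuous and satisfies, for every t ≤ t₀, φ(t) − m·a·∫_{−∞}^t e^{−a(t−z)}·φ(z) dz − (1−m)·b·∫_{−∞}^t e^{−b(t−z)}·φ(z) dz = W(t). -/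

import Mathlib

open Set MeasureTheory

/-- Convolution of `f` with the causal exponential kernel `x ↦ e^{θ x}`, `x ≥ 0`. -/
noncomputable def expConv (θ : ℝ) (f : ℝ → ℝ) (t : ℝ) : ℝ :=
  ∫ η in Set.Iic t, Real.exp (θ * (t - η)) * f η

section ExpConv

variable {θ A C : ℝ} {f : ℝ → ℝ}

theorem integrableOn_exp_mul_of_abs_le (hf : Continuous f)
    (hB : ∀ t, |f t| ≤ C * Real.exp (A * t)) (hθ : θ < A) (r t : ℝ) :
    IntegrableOn (fun η => Real.exp (θ * (r - η)) * f η) (Set.Iic t) := by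
  have hg := (integrableOn_exp_mul_Iic (sub_pos.2 hθ) t).const_mul (C * Real.exp (θ * r))
  refine Integrable.mono' hg (Continuous.aestronglyMeasurable (by fun_prop)) ?_
  refine Filter.Eventually.of_forall fun η => ?_
  rw [norm_mul, Real.norm_eq_abs, Real.norm_eq_abs, Real.abs_exp]
  calc Real.exp (θ * (r - η)) * |f η|
      ≤ Real.exp (θ * (r - η)) * (C * Real.exp (A * η)) := by gcongr; exact hB η
    _ = C * (Real.exp (θ * (r - η)) * Real.exp (A * η)) := by ring
    _ = C * (Real.exp (θ * r) * Real.exp ((A - θ) * η)) := by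
        rw [← Real.exp_add, ← Real.exp_add]; ring_nf
    _ = C * Real.exp (θ * r) * Real.exp ((A - θ) * η) := by ring

theorem abs_expConv_le (hB : ∀ t, |f t| ≤ C * Real.exp (A * t)) (hθ : θ < A) (t : ℝ) :
    |expConv θ f t| ≤ C / (A - θ) * Real.exp (A * t) := by
  have hg := (integrableOn_exp_mul_Iic (sub_pos.2 hθ) t).const_mul (C * Real.exp (θ * t))
  have h := norm_integral_le_of_norm_le (f := fun η => Real.exp (θ * (t - η)) * f η) hg
    (Filter.Eventually.of_forall fun η => by
      rw [norm_mul, Real.norm_eq_abs, Real.norm_eq_abs, Real.abs_exp]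
      calc Real.exp (θ * (t - η)) * |f η|
          ≤ Real.exp (θ * (t - η)) * (C * Real.exp (A * η)) := by gcongr; exact hB η
        _ = C * (Real.exp (θ * (t - η)) * Real.exp (A * η)) := by ring
        _ = C * (Real.exp (θ * t) * Real.exp ((A - θ) * η)) := by
            rw [← Real.exp_add, ← Real.exp_add]; ring_nf
        _ = C * Real.exp (θ * t) * Real.exp ((A - θ) * η) := by ring)
  rw [integral_const_mul, integral_exp_mul_Iic (sub_pos.2 hθ)] at h
  refine h.trans_eq ?_
  have : Real.exp (A * t) = Real.exp (θ * t) * Real.exp ((A - θ) * t) := by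
    rw [← Real.exp_add]; ring_nf
  rw [this]; ring

theorem hasDerivAt_expConv (hf : Continuous f)
    (hB : ∀ t, |f t| ≤ C * Real.exp (A * t)) (hθ : θ < A) (t : ℝ) :
    HasDerivAt (expConv θ f) (θ * expConv θ f t + f t) t := by
  set g : ℝ → ℝ := fun η => Real.exp (θ * (0 - η)) * f η with hg
  have hgc : Continuous g := by fun_prop
  have hgi : ∀ s, IntegrableOn g (Set.Iic s) := integrableOn_exp_mul_of_abs_le hf hB hθ 0
  have hE : ∀ s, expConv θ f s
      = Real.exp (θ * s) * ((∫ η in Set.Iic 0, g η) + ∫ η in (0 : ℝ)..s, g η) := by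
    intro s
    rw [← intervalIntegral.integral_Iic_sub_Iic (hgi 0) (hgi s), add_sub_cancel,
      ← integral_const_mul, expConv]
    congr 1 with η
    rw [hg, ← mul_assoc, ← Real.exp_add]
    ring_nf
  have hd : HasDerivAt (fun s => ∫ η in (0 : ℝ)..s, g η) (g t) t :=
    intervalIntegral.integral_hasDerivAt_right (hgc.intervalIntegrable _ _)
      hgc.aestronglyMeasurable.stronglyMeasurableAtFilter hgc.continuousAt
  have he : HasDerivAt (fun s => Real.exp (θ * s)) (Real.exp (θ * t) * (θ * 1)) t :=
    ((hasDerivAt_id t).const_mul θ).exp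
  have h := he.mul (hd.const_add (∫ η in Set.Iic 0, g η))
  rw [funext hE]
  refine h.congr_deriv ?_
  have h1 : Real.exp (θ * t) * g t = f t := by
    rw [hg, ← mul_assoc, ← Real.exp_add]
    ring_nf
    simp
  rw [h1]; ring

theorem continuous_expConv (hf : Continuous f)
    (hB : ∀ t, |f t| ≤ C * Real.exp (A * t)) (hθ : θ < A) : Continuous (expConv θ f) :=
  continuous_iff_continuousAt.2 fun t => (hasDerivAt_expConv hf hB hθ t).continuousAt

/-- Resolvent identity for the convolutions with exponential kernels. -/
theorem expConv_eq_expConv_expConv_add (hf : Continuous f)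
    (hB : ∀ t, |f t| ≤ C * Real.exp (A * t)) (hθ : θ < A) {κ : ℝ} (hκ : κ < A) (t : ℝ) :
    expConv θ f t = (θ - κ) * expConv κ (expConv θ f) t + expConv κ f t := by
  have huc := continuous_expConv hf hB hθ
  have huB := abs_expConv_le hB hθ
  have hi1 := (integrableOn_exp_mul_of_abs_le huc huB hκ t t).const_mul (θ - κ)
  have hi2 := integrableOn_exp_mul_of_abs_le hf hB hκ t t
  have hd : ∀ x, HasDerivAt (fun z => Real.exp (κ * (t - z)) * expConv θ f z)
      ((θ - κ) * (Real.exp (κ * (t - x)) * expConv θ f x) + Real.exp (κ * (t - x)) * f x) x := by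
    intro x
    have he : HasDerivAt (fun z => Real.exp (κ * (t - z)))
        (Real.exp (κ * (t - x)) * (κ * -1)) x :=
      (((hasDerivAt_id x).const_sub t).const_mul κ).exp
    refine (he.mul (hasDerivAt_expConv hf hB hθ x)).congr_deriv ?_
    ring
  have hlim : Filter.Tendsto (fun z => Real.exp (κ * (t - z)) * expConv θ f z) Filter.atBot
      (nhds 0) := by
    have h0 : Filter.Tendsto
        (fun z => Real.exp (κ * t) * (C / (A - θ)) * Real.exp ((A - κ) * z)) Filter.atBot
        (nhds 0) := by
      have := (Real.tendsto_exp_atBot.comp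
        (Filter.tendsto_id.const_mul_atBot (sub_pos.2 hκ))).const_mul
          (Real.exp (κ * t) * (C / (A - θ)))
      simpa using this
    refine squeeze_zero_norm (fun z => ?_) h0
    rw [norm_mul, Real.norm_eq_abs, Real.norm_eq_abs, Real.abs_exp]
    calc Real.exp (κ * (t - z)) * |expConv θ f z|
        ≤ Real.exp (κ * (t - z)) * (C / (A - θ) * Real.exp (A * z)) := by gcongr; exact huB z
      _ = C / (A - θ) * (Real.exp (κ * (t - z)) * Real.exp (A * z)) := by ring
      _ = C / (A - θ) * (Real.exp (κ * t) * Real.exp ((A - κ) * z)) := by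
          rw [← Real.exp_add, ← Real.exp_add]; ring_nf
      _ = _ := by ring
  have h := integral_Iic_of_hasDerivAt_of_tendsto' (a := t) (fun x _ => hd x) (hi1.add hi2) hlim
  rw [integral_add hi1 hi2, integral_const_mul] at h
  simpa [expConv] using h.symm

end ExpConv

/-- A linear combination of a function and two of its exponential convolutions is convolved
termwise. -/
theorem expConv_add_mul_add_mul {A C κ θ₁ θ₂ : ℝ} {f : ℝ → ℝ} (hf : Continuous f)
    (hB : ∀ t, |f t| ≤ C * Real.exp (A * t)) (hκ : κ < A) (h₁ : θ₁ < A) (h₂ : θ₂ < A)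
    (c₁ c₂ t : ℝ) :
    expConv κ (fun z => f z + c₁ * expConv θ₁ f z + c₂ * expConv θ₂ f z) t
      = expConv κ f t + c₁ * expConv κ (expConv θ₁ f) t
        + c₂ * expConv κ (expConv θ₂ f) t := by
  have i0 := integrableOn_exp_mul_of_abs_le hf hB hκ t t
  have i1 := (integrableOn_exp_mul_of_abs_le (continuous_expConv hf hB h₁)
    (abs_expConv_le hB h₁) hκ t t).const_mul c₁
  have i2 := (integrableOn_exp_mul_of_abs_le (continuous_expConv hf hB h₂)
    (abs_expConv_le hB h₂) hκ t t).const_mul c₂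
  have h := integral_add (i0.add i1) i2
  simp only [Pi.add_apply] at h
  rw [integral_add i0 i1, integral_const_mul, integral_const_mul] at h
  refine Eq.trans ?_ h
  rw [expConv]
  congr 1 with z
  ring

theorem expConv_congr {θ t : ℝ} {f g : ℝ → ℝ} (h : ∀ z ≤ t, f z = g z) :
    expConv θ f t = expConv θ g t :=
  setIntegral_congr_fun measurableSet_Iic fun z hz => by
    simp only [h z hz]

/-- The resolution formula `φ = W + G_r ⋆ W` (Green's function `G = δ₀ + G_r`) solves the
linear equation `𝓛φ = W`: if `|W(t)| ≤ C e^{-2at}` on `(-∞, t₀]` and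
`φ(t) = W(t) + ∫_{-∞}^t G_r(t-η) W(η) dη` with `G_r(x) = c₁ + c₂ e^{θ₂ x}`,
`θ₂ = -s`, `c₁ = ab/s`, `c₂ = ma + (1-m)b - ab/s`, `s = (1-m)a + mb > 0`, then `φ` is
continuous and `φ(t) - m a ∫_{-∞}^t e^{-a(t-z)} φ(z) dz - (1-m) b ∫_{-∞}^t e^{-b(t-z)} φ(z) dz = W(t)`
for every `t ≤ t₀`. -/
theorem resolution_formula
    (a b m t₀ C : ℝ) (ha : a < 0) (hb : 0 < b) (hm : m ∈ Set.Ioc (0 : ℝ) 1)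
    (hs : 0 < (1 - m) * a + m * b) (hC : 0 < C)
    (W : ℝ → ℝ) (hWc : ContinuousOn W (Set.Iic t₀))
    (hW : ∀ t ≤ t₀, |W t| ≤ C * Real.exp (-2 * a * t))
    (φ : ℝ → ℝ)
    (hφ : ∀ t ≤ t₀, φ t = W t + ∫ η in Set.Iic t,
      (a * b / ((1 - m) * a + m * b) +
        (m * a + (1 - m) * b - a * b / ((1 - m) * a + m * b)) *
          Real.exp (-((1 - m) * a + m * b) * (t - η))) * W η) :
    ContinuousOn φ (Set.Iic t₀) ∧
    ∀ t ≤ t₀,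
      φ t - m * a * (∫ z in Set.Iic t, Real.exp (-a * (t - z)) * φ z)
        - (1 - m) * b * (∫ z in Set.Iic t, Real.exp (-b * (t - z)) * φ z) = W t := by
  set s := (1 - m) * a + m * b with hs_def
  set c₁ := a * b / s
  set c₂ := m * a + (1 - m) * b - c₁ with hc₂
  set V : ℝ → ℝ := fun t => W (min t t₀) with hV
  have hVW : ∀ t ≤ t₀, V t = W t := fun t ht => by simp [hV, min_eq_left ht]
  have hVc : Continuous V :=
    hWc.comp_continuous (by fun_prop) fun t => min_le_right t t₀
  have hVB : ∀ t, |V t| ≤ C * Real.exp (-2 * a * t) := fun t =>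
    (hW _ (min_le_right t t₀)).trans (by
      gcongr
      · linarith
      · exact min_le_left t t₀)
  have h0 : (0 : ℝ) < -2 * a := by linarith
  have h1 : -s < -2 * a := by linarith
  have h2 : -a < -2 * a := by linarith
  have h3 : -b < -2 * a := by linarith
  have hφV : ∀ t ≤ t₀, φ t = V t + c₁ * expConv 0 V t + c₂ * expConv (-s) V t := by
    intro t ht
    have i0 := (integrableOn_exp_mul_of_abs_le hVc hVB h0 t t).const_mul c₁
    have i1 := (integrableOn_exp_mul_of_abs_le hVc hVB h1 t t).const_mul c₂
    rw [hφ t ht, hVW t ht, add_assoc, expConv, expConv, ← integral_const_mul,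
      ← integral_const_mul, ← integral_add i0 i1]
    congr 1
    refine setIntegral_congr_fun measurableSet_Iic fun η hη => ?_
    simp only [hVW η (le_trans hη ht), zero_mul, Real.exp_zero]
    ring
  refine ⟨?_, fun t ht => ?_⟩
  · have hc0 := continuous_expConv hVc hVB h0
    have hc1 := continuous_expConv hVc hVB h1
    exact (Continuous.continuousOn (by fun_prop)).congr hφV
  · have hE : ∀ κ, κ < -2 * a → ∫ z in Set.Iic t, Real.exp (κ * (t - z)) * φ z
        = expConv κ V t + c₁ * expConv κ (expConv 0 V) t
          + c₂ * expConv κ (expConv (-s) V) t := fun κ hκ => by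
      rw [← expConv_add_mul_add_mul hVc hVB hκ h0 h1]
      exact expConv_congr fun z hz => hφV z (hz.trans ht)
    rw [hE _ h2, hE _ h3, hφV t ht, ← hVW t ht]
    have ra0 := expConv_eq_expConv_expConv_add hVc hVB h0 h2 t
    have ras := expConv_eq_expConv_expConv_add hVc hVB h1 h2 t
    have rb0 := expConv_eq_expConv_expConv_add hVc hVB h0 h3 t
    have rbs := expConv_eq_expConv_expConv_add hVc hVB h1 h3 t
    have hab : a - b ≠ 0 := by linarith
    have hcs : c₁ * s = a * b := div_mul_cancel₀ _ hs.ne'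
    generalize expConv (-a) (expConv 0 V) t = A0 at *
    generalize expConv (-a) (expConv (-s) V) t = As at *
    generalize expConv (-b) (expConv 0 V) t = B0 at *
    generalize expConv (-b) (expConv (-s) V) t = Bs at *
    generalize expConv (-a) V t = Ua at *
    generalize expConv (-b) V t = Ub at *
    generalize expConv 0 V t = U0 at *
    generalize expConv (-s) V t = Us at *
    have ra0' : a * A0 = U0 - Ua := by linarith
    have rb0' : b * B0 = U0 - Ub := by linarith
    have ras' : m * As = (Us - Ua) / (a - b) := by
      rw [eq_div_iff hab, ras, hs_def]; ring
    have rbs' : (1 - m) * Bs = (Ub - Us) / (a - b) := by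
      rw [eq_div_iff hab, rbs, hs_def]; ring
    have key : V t + c₁ * U0 + c₂ * Us - m * a * (Ua + c₁ * A0 + c₂ * As)
        - (1 - m) * b * (Ub + c₁ * B0 + c₂ * Bs)
        = V t + c₁ * U0 + c₂ * Us - m * a * Ua - m * c₁ * (a * A0) - a * c₂ * (m * As)
          - (1 - m) * b * Ub - (1 - m) * c₁ * (b * B0) - b * c₂ * ((1 - m) * Bs) := by ring
    rw [key, ra0', rb0', ras', rbs', hc₂]
    rw [hs_def] at hcs
    clear_value c₁
    field_simp
    linear_combination (Ub - Ua) * hcs
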